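/- The matrices M₁ = [[0,1,2],[1,0,0],[0,3,5]] and M₂ = [[0,2,3],[1,1,1],[0,3,4]] both lie in SL(3,ℤ), have equal (irreducible over ℚ) characteristic polynomial t³ − 5t² − t − 1, are distinct perfect Hessenberg matrices of the same Hessenberg complexity 3, are integer conjugate to each other, and both are reduced. In particular, an operator may have two distinct reduced perfect Hessenberg matrices. -/

import Mathlib

open Matrix Polynomial

/-- An n×n integer matrix is (upper) Hessenberg if `M i j = 0` whenever `i > j+1`
(0-based indices). -/
def IsHessenberg {n : ℕ} (M : Matrix (Fin n) (Fin n) ℤ) : Prop :=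
  ∀ i j : Fin n, (j : ℕ) + 1 < (i : ℕ) → M i j = 0

/-- The subdiagonal entry `M (j+1) j` (0-based `j`), or `0` if out of range. -/
def subdiag {n : ℕ} (M : Matrix (Fin n) (Fin n) ℤ) (j : ℕ) : ℤ :=
  if h : j + 1 < n then M ⟨j + 1, h⟩ ⟨j, Nat.lt_of_succ_lt h⟩ else 0

/-- Hessenberg complexity `ς(M) = ∏_{j=1}^{n-1} |M (j+1) j|^(n-j)` (1-based). -/
def hessComplexity {n : ℕ} (M : Matrix (Fin n) (Fin n) ℤ) : ℤ :=
  ∏ j ∈ Finset.range (n - 1), |subdiag M j| ^ (n - 1 - j)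

/-- Integer conjugacy: `X * A * X⁻¹ = B` for some `X ∈ GL(n, ℤ)`. -/
def IntegerConjugate {n : ℕ} (A B : Matrix (Fin n) (Fin n) ℤ) : Prop :=
  ∃ X : Matrix (Fin n) (Fin n) ℤ, IsUnit X.det ∧ X * A = B * X

/-- Perfect Hessenberg matrix: in `SL(n,ℤ)`, Hessenberg, irreducible characteristic
polynomial over ℚ, and `0 ≤ M i j < M (j+1) j` for `1 ≤ i ≤ j ≤ n-1` (1-based). -/
def IsPerfect {n : ℕ} (M : Matrix (Fin n) (Fin n) ℤ) : Prop :=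
  M.det = 1 ∧ IsHessenberg M ∧
  Irreducible ((M.charpoly).map (Int.castRingHom ℚ)) ∧
  ∀ i j : Fin n, i ≤ j → (j : ℕ) + 1 < n → 0 ≤ M i j ∧ M i j < subdiag M (j : ℕ)

/-- A perfect Hessenberg matrix is reduced if its Hessenberg complexity is minimal
among all perfect Hessenberg matrices integer conjugate to it. -/
def IsReducedHess {n : ℕ} (W : Matrix (Fin n) (Fin n) ℤ) : Prop :=
  IsPerfect W ∧ ∀ M : Matrix (Fin n) (Fin n) ℤ, IsPerfect M → IntegerConjugate W M →
    hessComplexity W ≤ hessComplexity M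

/-- The matrix with columns `v`, `M v`, `M² v`. -/
def krylov (M : Matrix (Fin 3) (Fin 3) ℤ) (v : Fin 3 → ℤ) : Matrix (Fin 3) (Fin 3) ℤ :=
  (Matrix.of ![v, M *ᵥ v, M *ᵥ (M *ᵥ v)])ᵀ

theorem mul_krylov {X W M : Matrix (Fin 3) (Fin 3) ℤ} (h : X * W = M * X) (v : Fin 3 → ℤ) :
    X * krylov W v = krylov M (X *ᵥ v) := by
  have hc (u : Fin 3 → ℤ) : X *ᵥ (W *ᵥ u) = M *ᵥ (X *ᵥ u) := by
    rw [mulVec_mulVec, mulVec_mulVec, h]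
  ext i j
  change (X *ᵥ (krylov W v).col j) i = _
  fin_cases j
  · rfl
  · exact congrFun (hc v) i
  · exact congrFun ((hc _).trans (congrArg (M *ᵥ ·) (hc v))) i

theorem det_krylov_single {M : Matrix (Fin 3) (Fin 3) ℤ} (hM : IsHessenberg M) :
    (krylov M (Pi.single 0 1)).det = M 1 0 ^ 2 * M 2 1 := by
  have h : M 2 0 = 0 := hM 2 0 (by decide)
  simp [krylov, det_fin_three, mulVec, dotProduct, Fin.sum_univ_three, h]
  ring

theorem hessComplexity_fin_three (M : Matrix (Fin 3) (Fin 3) ℤ) :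
    hessComplexity M = |M 1 0| ^ 2 * |M 2 1| := by
  simp [hessComplexity, subdiag, Finset.prod_range_succ]

theorem IntegerConjugate.trans {n : ℕ} {A B C : Matrix (Fin n) (Fin n) ℤ}
    (h : IntegerConjugate A B) (h' : IntegerConjugate B C) : IntegerConjugate A C := by
  obtain ⟨X, hX, h⟩ := h
  obtain ⟨Y, hY, h'⟩ := h'
  refine ⟨Y * X, det_mul Y X ▸ hY.mul hX, ?_⟩
  rw [Matrix.mul_assoc, h, ← Matrix.mul_assoc, h', Matrix.mul_assoc]

/-- The complexity of a Hessenberg matrix integer conjugate to `W` is, up to sign, a value of the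
cubic form `v ↦ det (v, W v, W² v)`. -/
theorem exists_abs_det_krylov_eq_hessComplexity {W M : Matrix (Fin 3) (Fin 3) ℤ}
    (hM : IsHessenberg M) (h : IntegerConjugate W M) :
    ∃ v, |(krylov W v).det| = hessComplexity M := by
  obtain ⟨X, hX, h⟩ := h
  refine ⟨X⁻¹ *ᵥ Pi.single 0 1, ?_⟩
  have hk := congrArg det (mul_krylov h (X⁻¹ *ᵥ Pi.single 0 1))
  rw [mulVec_mulVec, mul_nonsing_inv X hX, one_mulVec, det_mul, det_krylov_single hM] at hk
  rw [hessComplexity_fin_three, ← abs_pow, ← abs_mul, ← hk, abs_mul,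
    Int.isUnit_iff_abs_eq.mp hX, one_mul]

theorem IsPerfect.hessComplexity_pos {M : Matrix (Fin 3) (Fin 3) ℤ} (hM : IsPerfect M) :
    0 < hessComplexity M := by
  obtain ⟨-, -, -, h⟩ := hM
  have h0 := h 0 0 le_rfl (by decide)
  have h1 := h 1 1 le_rfl (by decide)
  have h10 : 0 < M 1 0 := h0.1.trans_lt h0.2
  have h21 : 0 < M 2 1 := h1.1.trans_lt h1.2
  rw [hessComplexity_fin_three]
  positivity

/-- Modulo 7 the characteristic polynomial is the cube of a linear polynomial, and the form
`v ↦ det (v, M v, M² v)` is three times the cube of a linear form. -/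
theorem det_krylov_mod_seven (v : Fin 3 → ℤ) :
    (krylov !![0, 1, 2; 1, 0, 0; 0, 3, 5] v).det ≡
      3 * (v 0 + 4 * v 1 + 5 * v 2) ^ 3 [ZMOD 7] := by
  rw [Int.modEq_iff_dvd]
  refine ⟨3 * v 0 ^ 2 * v 1 + 3 * v 0 ^ 2 * v 2 + 21 * v 0 * v 1 ^ 2 + 54 * v 0 * v 1 * v 2 +
    35 * v 0 * v 2 ^ 2 + 27 * v 1 ^ 3 + 102 * v 1 ^ 2 * v 2 + 128 * v 1 * v 2 ^ 2 +
    53 * v 2 ^ 3, ?_⟩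
  simp [krylov, det_fin_three, dotProduct, Fin.sum_univ_three]
  ring

theorem three_mul_cube_mod_seven (x : ℤ) :
    3 * x ^ 3 % 7 = 0 ∨ 3 * x ^ 3 % 7 = 3 ∨ 3 * x ^ 3 % 7 = 4 := by
  have : x % 7 = 0 ∨ x % 7 = 1 ∨ x % 7 = 2 ∨ x % 7 = 3 ∨ x % 7 = 4 ∨ x % 7 = 5 ∨ x % 7 = 6 := by
    omega
  rcases this with h | h | h | h | h | h | h <;> simp [pow_succ, Int.mul_emod, h]

theorem three_le_hessComplexity {M : Matrix (Fin 3) (Fin 3) ℤ} (hM : IsPerfect M)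
    (h : IntegerConjugate !![0, 1, 2; 1, 0, 0; 0, 3, 5] M) : 3 ≤ hessComplexity M := by
  obtain ⟨v, hv⟩ := exists_abs_det_krylov_eq_hessComplexity hM.2.1 h
  have hpos := hM.hessComplexity_pos
  have hc := three_mul_cube_mod_seven (v 0 + 4 * v 1 + 5 * v 2)
  rw [← (det_krylov_mod_seven v).eq] at hc
  rw [← hv] at hpos ⊢
  generalize (krylov _ v).det = d at *
  rcases abs_cases d with h | h <;> omega

theorem monic_cubic : (X ^ 3 - C 5 * X ^ 2 - C 1 * X - C 1 : ℤ[X]).Monic := by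
  monicity!

theorem natDegree_cubic : (X ^ 3 - C 5 * X ^ 2 - C 1 * X - C 1 : ℤ[X]).natDegree = 3 := by
  compute_degree!

theorem irreducible_cubic : Irreducible (X ^ 3 - C 5 * X ^ 2 - C 1 * X - C 1 : ℤ[X]) := by
  rw [monic_cubic.irreducible_iff_roots_eq_zero_of_degree_le_three
    (by rw [natDegree_cubic]; decide) natDegree_cubic.le]
  refine Multiset.eq_zero_of_forall_notMem fun x hx => ?_
  have h := (mem_roots'.mp hx).2
  simp only [IsRoot.def, eval_sub, eval_mul, eval_pow, eval_X, eval_C] at h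
  have hu : x ∣ 1 := ⟨x ^ 2 - 5 * x - 1, by linear_combination -h⟩
  rcases Int.isUnit_iff.mp (isUnit_of_dvd_one hu) with rfl | rfl <;> norm_num at h

theorem irreducible_map_cubic :
    Irreducible ((X ^ 3 - C 5 * X ^ 2 - C 1 * X - C 1 : ℤ[X]).map (Int.castRingHom ℚ)) :=
  (monic_cubic.irreducible_iff_irreducible_map_fraction_map (K := ℚ)).mp irreducible_cubic

theorem charpoly_first :
    (!![0, 1, 2; 1, 0, 0; 0, 3, 5] : Matrix (Fin 3) (Fin 3) ℤ).charpoly =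
      X ^ 3 - C 5 * X ^ 2 - C 1 * X - C 1 := by
  simp [Matrix.charpoly, det_fin_three]
  ring

theorem charpoly_second :
    (!![0, 2, 3; 1, 1, 1; 0, 3, 4] : Matrix (Fin 3) (Fin 3) ℤ).charpoly =
      X ^ 3 - C 5 * X ^ 2 - C 1 * X - C 1 := by
  simp [Matrix.charpoly, det_fin_three]
  ring

theorem isPerfect_first :
    IsPerfect (!![0, 1, 2; 1, 0, 0; 0, 3, 5] : Matrix (Fin 3) (Fin 3) ℤ) := by
  refine ⟨by decide, fun i j => ?_, charpoly_first ▸ irreducible_map_cubic, fun i j => ?_⟩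
  all_goals fin_cases i <;> fin_cases j <;> simp [subdiag]

theorem isPerfect_second :
    IsPerfect (!![0, 2, 3; 1, 1, 1; 0, 3, 4] : Matrix (Fin 3) (Fin 3) ℤ) := by
  refine ⟨by decide, fun i j => ?_, charpoly_second ▸ irreducible_map_cubic, fun i j => ?_⟩
  all_goals fin_cases i <;> fin_cases j <;> simp [subdiag]

theorem hessComplexity_first :
    hessComplexity (!![0, 1, 2; 1, 0, 0; 0, 3, 5] : Matrix (Fin 3) (Fin 3) ℤ) = 3 := by
  simp [hessComplexity_fin_three]

theorem hessComplexity_second :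
    hessComplexity (!![0, 2, 3; 1, 1, 1; 0, 3, 4] : Matrix (Fin 3) (Fin 3) ℤ) = 3 := by
  simp [hessComplexity_fin_three]

theorem integerConjugate_first_second :
    IntegerConjugate (!![0, 1, 2; 1, 0, 0; 0, 3, 5] : Matrix (Fin 3) (Fin 3) ℤ)
      !![0, 2, 3; 1, 1, 1; 0, 3, 4] :=
  ⟨!![0, 1, 1; -1, 0, 1; 1, 1, 1], by simp [det_fin_three], by decide⟩

/-- the matrices `M₁ = [[0,1,2],[1,0,0],[0,3,5]]` and
`M₂ = [[0,2,3],[1,1,1],[0,3,4]]` lie in `SL(3,ℤ)`, have the same irreducible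
characteristic polynomial `t³ − 5t² − t − 1`, are distinct perfect Hessenberg matrices
of Hessenberg complexity 3, are integer conjugate, and both are reduced. -/
theorem statement19 :
    (!![0, 1, 2; 1, 0, 0; 0, 3, 5] : Matrix (Fin 3) (Fin 3) ℤ).det = 1 ∧
    (!![0, 2, 3; 1, 1, 1; 0, 3, 4] : Matrix (Fin 3) (Fin 3) ℤ).det = 1 ∧
    (!![0, 1, 2; 1, 0, 0; 0, 3, 5] : Matrix (Fin 3) (Fin 3) ℤ).charpoly =
      X ^ 3 - C 5 * X ^ 2 - C 1 * X - C 1 ∧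
    (!![0, 2, 3; 1, 1, 1; 0, 3, 4] : Matrix (Fin 3) (Fin 3) ℤ).charpoly =
      (!![0, 1, 2; 1, 0, 0; 0, 3, 5] : Matrix (Fin 3) (Fin 3) ℤ).charpoly ∧
    Irreducible
      (((!![0, 1, 2; 1, 0, 0; 0, 3, 5] : Matrix (Fin 3) (Fin 3) ℤ).charpoly).map
        (Int.castRingHom ℚ)) ∧
    IsPerfect (!![0, 1, 2; 1, 0, 0; 0, 3, 5] : Matrix (Fin 3) (Fin 3) ℤ) ∧
    IsPerfect (!![0, 2, 3; 1, 1, 1; 0, 3, 4] : Matrix (Fin 3) (Fin 3) ℤ) ∧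
    (!![0, 1, 2; 1, 0, 0; 0, 3, 5] : Matrix (Fin 3) (Fin 3) ℤ) ≠
      !![0, 2, 3; 1, 1, 1; 0, 3, 4] ∧
    hessComplexity (!![0, 1, 2; 1, 0, 0; 0, 3, 5] : Matrix (Fin 3) (Fin 3) ℤ) = 3 ∧
    hessComplexity (!![0, 2, 3; 1, 1, 1; 0, 3, 4] : Matrix (Fin 3) (Fin 3) ℤ) = 3 ∧
    IntegerConjugate (!![0, 1, 2; 1, 0, 0; 0, 3, 5] : Matrix (Fin 3) (Fin 3) ℤ)
      !![0, 2, 3; 1, 1, 1; 0, 3, 4] ∧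
    IsReducedHess (!![0, 1, 2; 1, 0, 0; 0, 3, 5] : Matrix (Fin 3) (Fin 3) ℤ) ∧
    IsReducedHess (!![0, 2, 3; 1, 1, 1; 0, 3, 4] : Matrix (Fin 3) (Fin 3) ℤ) := by
  refine ⟨by decide, by decide, charpoly_first, charpoly_second.trans charpoly_first.symm,
    isPerfect_first.2.2.1, isPerfect_first, isPerfect_second, by decide, hessComplexity_first,
    hessComplexity_second, integerConjugate_first_second, ⟨isPerfect_first, fun M hM h => ?_⟩,
    ⟨isPerfect_second, fun M hM h => ?_⟩⟩
  · exact hessComplexity_first.trans_le (three_le_hessComplexity hM h)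
  · exact hessComplexity_second.trans_le
      (three_le_hessComplexity hM (integerConjugate_first_second.trans h))
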